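/- arXiv:2604.23609 — 3 statements merged into one kernel-verified Lean document; each statement's English description precedes it below -/
import Mathlib

section
/- Let V : ℕ → ℝ be a sequence with V(t) ≥ 0 for all t, let H ≥ 1 be an integer, and let 0 ≤ L < 1, 0 ≤ λ < 1, c ≥ 0, ε_d ≥ 0 be constants. Suppose V(t+1) ≤ λ·V(t) + ε_d whenever H divides t, and V(t+1) ≤ L·V(t) + c whenever H does not divide t. Then the sequence z(k) := V(k·H + 1) of post-correction errors satisfies z(k+1) ≤ α·z(k) + β for all k, where α := λ·L^{H−1} and β := λ·((1 − L^{H−1})/(1 − L))·c + ε_d. -/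
/-- Iterating a one-step affine bound `u (j + 1) ≤ L * u j + c` for `n` steps. -/
theorem le_pow_mul_add_of_le_mul_add {u : ℕ → ℝ} {L c : ℝ} (hL0 : 0 ≤ L) (hL1 : L ≠ 1) (n : ℕ)
    (hu : ∀ j < n, u (j + 1) ≤ L * u j + c) :
    u n ≤ L ^ n * u 0 + (1 - L ^ n) / (1 - L) * c := by
  induction n with
  | zero => simp
  | succ n ih =>
    have hL : 1 - L ≠ 0 := sub_ne_zero.mpr hL1.symm
    calc u (n + 1) ≤ L * u n + c := hu n n.lt_succ_self
      _ ≤ L * (L ^ n * u 0 + (1 - L ^ n) / (1 - L) * c) + c := by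
        gcongr
        exact ih fun j hj => hu j (hj.trans n.lt_succ_self)
      _ = L ^ (n + 1) * u 0 + (1 - L ^ (n + 1)) / (1 - L) * c := by
        field_simp
        ring

theorem tdp_cross_cycle_recursion
    (V : ℕ → ℝ) (hV : ∀ t, 0 ≤ V t)
    (H : ℕ) (hH : 1 ≤ H)
    (L lam c εd : ℝ) (hL0 : 0 ≤ L) (hL1 : L < 1)
    (hlam0 : 0 ≤ lam) (hlam1 : lam < 1) (hc : 0 ≤ c) (hεd : 0 ≤ εd)
    (hdiff : ∀ t, H ∣ t → V (t + 1) ≤ lam * V t + εd)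
    (hstream : ∀ t, ¬ H ∣ t → V (t + 1) ≤ L * V t + c) :
    ∀ k : ℕ,
      V ((k + 1) * H + 1) ≤
        (lam * L ^ (H - 1)) * V (k * H + 1) +
          (lam * ((1 - L ^ (H - 1)) / (1 - L)) * c + εd) := by
  intro k
  have hcycle : k * H + 1 + (H - 1) = (k + 1) * H := by
    rw [add_one_mul]
    omega
  have hbound := le_pow_mul_add_of_le_mul_add (u := fun j => V (k * H + 1 + j)) hL0 hL1.ne (H - 1)
    fun j hj => hstream (k * H + 1 + j) fun hdvd => by
      rw [add_assoc, Nat.dvd_add_right (dvd_mul_left H k)] at hdvd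
      have := Nat.le_of_dvd (by omega) hdvd
      omega
  simp only [hcycle, add_zero] at hbound
  calc V ((k + 1) * H + 1) ≤ lam * V ((k + 1) * H) + εd := hdiff _ (dvd_mul_left H (k + 1))
    _ ≤ lam * (L ^ (H - 1) * V (k * H + 1) + (1 - L ^ (H - 1)) / (1 - L) * c) + εd := by gcongr
    _ = _ := by ring
end

section
/- Let V : ℕ → ℝ be a sequence with V(t) ≥ 0 for all t, let H ≥ 1 be an integer, and let 0 ≤ L < 1, 0 ≤ λ < 1, c ≥ 0, ε_d ≥ 0 be constants. Suppose V(t+1) ≤ λ·V(t) + ε_d whenever H divides t, and V(t+1) ≤ L·V(t) + c whenever H does not divide t. Then limsup_{k→∞} V(k·H + 1) ≤ β/(1 − α), where α := λ·L^{H−1} and β := λ·((1 − L^{H−1})/(1 − L))·c + ε_d; in particular the sequence of post-correction errors is uniformly ultimately bounded. -/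
theorem le_of_affine_recursion {u : ℕ → ℝ} {a b : ℝ} (ha0 : 0 ≤ a) (ha1 : a < 1) (N : ℕ)
    (hu : ∀ n < N, u (n + 1) ≤ a * u n + b) :
    u N ≤ a ^ N * u 0 + (1 - a ^ N) / (1 - a) * b := by
  induction N with
  | zero => simp
  | succ N ih =>
    have h1 : (1 - a) ≠ 0 := by linarith
    calc u (N + 1) ≤ a * u N + b := hu N N.lt_succ_self
      _ ≤ a * (a ^ N * u 0 + (1 - a ^ N) / (1 - a) * b) + b := by
        gcongr
        exact ih fun n hn => hu n (hn.trans N.lt_succ_self)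
      _ = a ^ (N + 1) * u 0 + (1 - a ^ (N + 1)) / (1 - a) * b := by
        field_simp
        ring

theorem limsup_le_of_affine_recursion {u : ℕ → ℝ} {a b : ℝ} (hu0 : ∀ n, 0 ≤ u n)
    (ha0 : 0 ≤ a) (ha1 : a < 1) (hu : ∀ n, u (n + 1) ≤ a * u n + b) :
    Filter.limsup u Filter.atTop ≤ b / (1 - a) := by
  have hpow := tendsto_pow_atTop_nhds_zero_of_lt_one ha0 ha1
  have hlim : Filter.Tendsto (fun n => a ^ n * u 0 + (1 - a ^ n) / (1 - a) * b) Filter.atTop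
      (nhds (b / (1 - a))) := by
    convert (hpow.mul_const (u 0)).add
      (((hpow.const_sub 1).div_const (1 - a)).mul_const b) using 2
    ring
  rw [← hlim.limsup_eq]
  exact Filter.limsup_le_limsup
    (Filter.Eventually.of_forall fun N => le_of_affine_recursion ha0 ha1 N fun n _ => hu n)
    (Filter.isCoboundedUnder_le_of_le Filter.atTop hu0) hlim.isBoundedUnder_le

theorem tdp_post_correction_limsup
    (V : ℕ → ℝ) (hV : ∀ t, 0 ≤ V t)
    (H : ℕ) (hH : 1 ≤ H)
    (L lam c εd : ℝ) (hL0 : 0 ≤ L) (hL1 : L < 1)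
    (hlam0 : 0 ≤ lam) (hlam1 : lam < 1) (hc : 0 ≤ c) (hεd : 0 ≤ εd)
    (hdiff : ∀ t, H ∣ t → V (t + 1) ≤ lam * V t + εd)
    (hstream : ∀ t, ¬ H ∣ t → V (t + 1) ≤ L * V t + c) :
    Filter.limsup (fun k => V (k * H + 1)) Filter.atTop ≤
      (lam * ((1 - L ^ (H - 1)) / (1 - L)) * c + εd) / (1 - lam * L ^ (H - 1)) := by
  have hα1 : lam * L ^ (H - 1) < 1 :=
    (mul_le_of_le_one_right hlam0 (pow_le_one₀ hL0 hL1.le)).trans_lt hlam1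
  refine limsup_le_of_affine_recursion (fun k => hV _) (by positivity) hα1 fun k => ?_
  have hrun : V (k * H + 1 + (H - 1)) ≤
      L ^ (H - 1) * V (k * H + 1) + (1 - L ^ (H - 1)) / (1 - L) * c := by
    refine le_of_affine_recursion (u := fun j => V (k * H + 1 + j)) hL0 hL1 (H - 1)
      fun j hj => hstream (k * H + 1 + j) fun hdvd => ?_
    rw [add_assoc, Nat.dvd_add_right (dvd_mul_left H k)] at hdvd
    have := Nat.le_of_dvd (by omega) hdvd
    omega
  have hend : k * H + 1 + (H - 1) = (k + 1) * H := by
    rw [add_mul]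
    omega
  rw [hend] at hrun
  calc V ((k + 1) * H + 1) ≤ lam * V ((k + 1) * H) + εd := hdiff _ (dvd_mul_left H _)
    _ ≤ lam * (L ^ (H - 1) * V (k * H + 1) + (1 - L ^ (H - 1)) / (1 - L) * c) + εd := by
      gcongr
    _ = lam * L ^ (H - 1) * V (k * H + 1) +
        (lam * ((1 - L ^ (H - 1)) / (1 - L)) * c + εd) := by
      ring
end

section
/- Let V : ℕ → ℝ be a sequence with V(t) ≥ 0 for all t, let H ≥ 1 be an integer, and let 0 ≤ L < 1, 0 ≤ λ < 1, c ≥ 0, ε_d ≥ 0 be constants. Suppose V(t+1) ≤ λ·V(t) + ε_d whenever H divides t, and V(t+1) ≤ L·V(t) + c whenever H does not divide t. Then limsup_{t→∞} V(t) ≤ β/(1 − α) + c/(1 − L), where α := λ·L^{H−1} and β := λ·((1 − L^{H−1})/(1 − L))·c + ε_d; in particular the full tracking-error trajectory is uniformly ultimately bounded. -/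
/-- Discrete affine Grönwall bound on a finite horizon. -/
theorem le_geometric_of_affine_step {u : ℕ → ℝ} {a b : ℝ} (ha0 : 0 ≤ a) (ha1 : a < 1) {n : ℕ}
    (h : ∀ i < n, u (i + 1) ≤ a * u i + b) :
    u n ≤ a ^ n * u 0 + (1 - a ^ n) / (1 - a) * b := by
  induction n with
  | zero => simp
  | succ n ih =>
    have hne : 1 - a ≠ 0 := by linarith
    calc u (n + 1) ≤ a * u n + b := h n n.lt_succ_self
      _ ≤ a * (a ^ n * u 0 + (1 - a ^ n) / (1 - a) * b) + b := by
        gcongr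
        exact ih fun i hi => h i (hi.trans n.lt_succ_self)
      _ = a ^ (n + 1) * u 0 + (1 - a ^ (n + 1)) / (1 - a) * b := by
        field_simp
        ring

theorem geometric_div_mul_le {a b : ℝ} (ha0 : 0 ≤ a) (ha1 : a < 1) (hb : 0 ≤ b) (n : ℕ) :
    (1 - a ^ n) / (1 - a) * b ≤ b / (1 - a) := by
  have h : 0 < 1 - a := sub_pos.2 ha1
  rw [div_mul_eq_mul_div]
  gcongr
  exact mul_le_of_le_one_left hb (sub_le_self _ (pow_nonneg ha0 n))

theorem tdp_full_trajectory_limsup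
    (V : ℕ → ℝ) (hV : ∀ t, 0 ≤ V t)
    (H : ℕ) (hH : 1 ≤ H)
    (L lam c εd : ℝ) (hL0 : 0 ≤ L) (hL1 : L < 1)
    (hlam0 : 0 ≤ lam) (hlam1 : lam < 1) (hc : 0 ≤ c) (hεd : 0 ≤ εd)
    (hdiff : ∀ t, H ∣ t → V (t + 1) ≤ lam * V t + εd)
    (hstream : ∀ t, ¬ H ∣ t → V (t + 1) ≤ L * V t + c) :
    Filter.limsup V Filter.atTop ≤
      (lam * ((1 - L ^ (H - 1)) / (1 - L)) * c + εd) / (1 - lam * L ^ (H - 1)) +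
        c / (1 - L) := by
  set α := lam * L ^ (H - 1) with hα
  set β := lam * ((1 - L ^ (H - 1)) / (1 - L)) * c + εd with hβ
  have hα0 : 0 ≤ α := by positivity
  have hα1 : α < 1 :=
    (mul_le_of_le_one_right hlam0 (pow_le_one₀ hL0 hL1.le)).trans_lt hlam1
  have hβ0 : 0 ≤ β := by
    have h1 : 0 ≤ 1 - L ^ (H - 1) := sub_nonneg.2 (pow_le_one₀ hL0 hL1.le)
    have h2 : 0 ≤ 1 - L := sub_nonneg.2 hL1.le
    positivity
  have cycle (k j : ℕ) (hj : j < H) :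
      V (H * k + 1 + j) ≤ L ^ j * V (H * k + 1) + (1 - L ^ j) / (1 - L) * c := by
    refine le_geometric_of_affine_step (u := fun i => V (H * k + 1 + i)) hL0 hL1 fun i hi => ?_
    refine hstream (H * k + 1 + i) fun hdvd => ?_
    rw [add_assoc, Nat.dvd_add_right (dvd_mul_right H k)] at hdvd
    have := Nat.le_of_dvd (by omega) hdvd
    omega
  have step (k : ℕ) : V (H * (k + 1) + 1) ≤ α * V (H * k + 1) + β := by
    have h := cycle k (H - 1) (by omega)
    rw [show H * k + 1 + (H - 1) = H * (k + 1) by rw [mul_add]; omega] at h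
    calc V (H * (k + 1) + 1) ≤ lam * V (H * (k + 1)) + εd := hdiff _ (dvd_mul_right _ _)
      _ ≤ lam * (L ^ (H - 1) * V (H * k + 1) + (1 - L ^ (H - 1)) / (1 - L) * c) + εd := by
        gcongr
      _ = α * V (H * k + 1) + β := by rw [hα, hβ]; ring
  have post (k : ℕ) : V (H * k + 1) ≤ α ^ k * V 1 + β / (1 - α) := by
    have h := le_geometric_of_affine_step (u := fun k => V (H * k + 1)) (n := k) hα0 hα1
      fun i _ => step i
    have := geometric_div_mul_le hα0 hα1 hβ0 k
    simp only [mul_zero, zero_add] at h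
    linarith
  have bound (t : ℕ) : V (t + 1) ≤ α ^ (t / H) * V 1 + β / (1 - α) + c / (1 - L) := by
    have h := cycle (t / H) (t % H) (Nat.mod_lt _ hH)
    rw [show H * (t / H) + 1 + t % H = t + 1 by have := Nat.div_add_mod t H; omega] at h
    have h1 := geometric_div_mul_le hL0 hL1 hc (t % H)
    have h2 : L ^ (t % H) * V (H * (t / H) + 1) ≤ V (H * (t / H) + 1) :=
      mul_le_of_le_one_left (hV _) (pow_le_one₀ hL0 hL1.le)
    linarith [post (t / H)]
  have lim : Filter.Tendsto (fun t : ℕ => α ^ (t / H) * V 1 + β / (1 - α) + c / (1 - L))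
      Filter.atTop (nhds (β / (1 - α) + c / (1 - L))) := by
    have hpow := (tendsto_pow_atTop_nhds_zero_of_lt_one hα0 hα1).comp
      (Nat.tendsto_div_const_atTop (show H ≠ 0 by omega))
    simpa using ((hpow.mul_const (V 1)).add_const (β / (1 - α))).add_const (c / (1 - L))
  rw [← Filter.limsup_nat_add V 1, ← lim.limsup_eq]
  exact Filter.limsup_le_limsup (Filter.Eventually.of_forall bound)
    (Filter.isCoboundedUnder_le_of_le Filter.atTop fun t => hV (t + 1)) lim.isBoundedUnder_le
end
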